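/- Correctness and policy-independence of the Bayes filter: for every policy π, every t ≤ ℓ, and every history o ∈ O_t with Pr_π(o_t = o) > 0, the history o is reachable (∑_x μ(o)(x) > 0) and the conditional distribution of the hidden state given the history equals the normalized filter: Pr_π(x_t = x | o_t = o) = β(o)(x) for every x ∈ X. In particular, the conditional state distribution given the history does not depend on the policy. -/

import Mathlib

open scoped Classical

namespace DecPOMDP

variable {X U Z : Type}

/-- Auxiliary filter, recursing on the (reversed) history. -/
noncomputable def filtAux [Fintype X] (s0 : X → ℝ) (p : X → U → X → Z → ℝ) :
    List (U × Z) → X → ℝ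
  | [], x => s0 x
  | uz :: rest, y => ∑ x, filtAux s0 p rest x * p x uz.1 y uz.2

/-- The policy-independent unnormalized filter `μ`:
`filt s0 p [] = s0` and `filt s0 p (o ++ [(u,z)]) y = ∑ x, filt s0 p o x * p x u y z`. -/
noncomputable def filt [Fintype X] (s0 : X → ℝ) (p : X → U → X → Z → ℝ)
    (o : List (U × Z)) (x : X) : ℝ :=
  filtAux s0 p o.reverse x

/-- A history is reachable if its total filter mass is positive. -/
def reachable [Fintype X] (s0 : X → ℝ) (p : X → U → X → Z → ℝ)
    (o : List (U × Z)) : Prop :=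
  0 < ∑ x, filt s0 p o x

/-- The belief (normalized filter) of a history. -/
noncomputable def bel [Fintype X] (s0 : X → ℝ) (p : X → U → X → Z → ℝ)
    (o : List (U × Z)) (x : X) : ℝ :=
  filt s0 p o x / ∑ x', filt s0 p o x'

/-- Optimal history value with `k` stages to go: `Vstar s0 p r γ (ℓ - t)` is `V*_t`. -/
noncomputable def Vstar [Fintype X] [Fintype U] [Fintype Z] [Nonempty U]
    (s0 : X → ℝ) (p : X → U → X → Z → ℝ) (r : X → U → ℝ) (γ : ℝ) :
    ℕ → List (U × Z) → ℝ
  | 0, _ => 0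
  | k + 1, o =>
    Finset.univ.sup' Finset.univ_nonempty fun u : U =>
      (∑ x, bel s0 p o x * r x u) +
        γ * ∑ z : Z,
          if reachable s0 p (o ++ [(u, z)]) then
            (∑ x, ∑ y, bel s0 p o x * p x u y z) * Vstar s0 p r γ k (o ++ [(u, z)])
          else 0

/-- Optimal history action-value: `Qstar s0 p r γ (ℓ - t - 1)` is `Q*_t` (for `t < ℓ`). -/
noncomputable def Qstar [Fintype X] [Fintype U] [Fintype Z] [Nonempty U]
    (s0 : X → ℝ) (p : X → U → X → Z → ℝ) (r : X → U → ℝ) (γ : ℝ)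
    (k : ℕ) (o : List (U × Z)) (u : U) : ℝ :=
  (∑ x, bel s0 p o x * r x u) +
    γ * ∑ z : Z,
      if reachable s0 p (o ++ [(u, z)]) then
        (∑ x, ∑ y, bel s0 p o x * p x u y z) * Vstar s0 p r γ k (o ++ [(u, z)])
      else 0

/-- The history generated up to stage `t` by policy `π` along observation stream `z`
(`z t` being the observation received at stage `t+1`). -/
def hist (π : List (U × Z) → U) (z : ℕ → Z) : ℕ → List (U × Z)
  | 0 => []
  | t + 1 => hist π z t ++ [(π (hist π z t), z t)]

/-- Extend a finitely indexed stream to `ℕ` (junk beyond `m`). -/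
noncomputable def extend {α : Type} [Nonempty α] (m : ℕ) (f : Fin m → α) (t : ℕ) : α :=
  if h : t < m then f ⟨t, h⟩ else Classical.arbitrary α

/-- Expected discounted return `J(π)`: a finite sum over trajectories
`(x_0, …, x_ℓ, z_1, …, z_ℓ)` of the trajectory probability times the discounted return,
actions being chosen by `π` on the generated histories. -/
noncomputable def Jret [Fintype X] [Fintype U] [Fintype Z] [Nonempty X] [Nonempty Z]
    (s0 : X → ℝ) (p : X → U → X → Z → ℝ) (r : X → U → ℝ) (γ : ℝ) (ℓ : ℕ)
    (π : List (U × Z) → U) : ℝ :=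
  ∑ x : Fin (ℓ + 1) → X, ∑ z : Fin ℓ → Z,
    (s0 (extend (ℓ + 1) x 0) *
        ∏ t ∈ Finset.range ℓ,
          p (extend (ℓ + 1) x t) (π (hist π (extend ℓ z) t))
            (extend (ℓ + 1) x (t + 1)) (extend ℓ z t)) *
      ∑ t ∈ Finset.range ℓ, γ ^ t * r (extend (ℓ + 1) x t) (π (hist π (extend ℓ z) t))

/-- `Pr_π(o_t = o ∧ x_t = xh)`: a finite sum over partial trajectories. -/
noncomputable def PrHS [Fintype X] [Fintype U] [Fintype Z] [Nonempty X] [Nonempty Z]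
    (s0 : X → ℝ) (p : X → U → X → Z → ℝ) (π : List (U × Z) → U)
    (t : ℕ) (o : List (U × Z)) (xh : X) : ℝ :=
  ∑ x : Fin (t + 1) → X, ∑ z : Fin t → Z,
    if hist π (extend t z) t = o ∧ extend (t + 1) x t = xh then
      s0 (extend (t + 1) x 0) *
        ∏ s ∈ Finset.range t,
          p (extend (t + 1) x s) (π (hist π (extend t z) s))
            (extend (t + 1) x (s + 1)) (extend t z s)
    else 0

/-- `Pr_π(o_t = o)`. -/
noncomputable def PrH [Fintype X] [Fintype U] [Fintype Z] [Nonempty X] [Nonempty Z]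
    (s0 : X → ℝ) (p : X → U → X → Z → ℝ) (π : List (U × Z) → U)
    (t : ℕ) (o : List (U × Z)) : ℝ :=
  ∑ xh, PrHS s0 p π t o xh

end DecPOMDP

namespace DecPOMDP

variable {X U Z : Type}

lemma extend_snoc_of_lt {α : Type} [Nonempty α] {m s : ℕ} (f : Fin m → α) (a : α) (h : s < m) :
    extend (m + 1) (Fin.snoc f a : Fin (m + 1) → α) s = extend m f s := by
  simp [extend, h, h.trans (Nat.lt_succ_self m), Fin.snoc]

lemma extend_snoc_self {α : Type} [Nonempty α] (m : ℕ) (f : Fin m → α) (a : α) :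
    extend (m + 1) (Fin.snoc f a : Fin (m + 1) → α) m = a := by
  simp [extend, Fin.snoc]

lemma hist_congr (π : List (U × Z) → U) {z z' : ℕ → Z} {t : ℕ} (h : ∀ s < t, z s = z' s) :
    hist π z t = hist π z' t := by
  induction t with
  | zero => rfl
  | succ t ih =>
    simp only [hist, ih fun s hs => h s (hs.trans (Nat.lt_succ_self t)),
      h t (Nat.lt_succ_self t)]

lemma hist_extend_snoc [Nonempty Z] (π : List (U × Z) → U) {t s : ℕ} (f : Fin t → Z) (a : Z)
    (hs : s ≤ t) :
    hist π (extend (t + 1) (Fin.snoc f a : Fin (t + 1) → Z)) s = hist π (extend t f) s :=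
  hist_congr π fun _ hr => extend_snoc_of_lt f a (hr.trans_le hs)

lemma sum_fin_snoc {α : Type} [Fintype α] (n : ℕ) (F : (Fin (n + 1) → α) → ℝ) :
    ∑ x, F x = ∑ f : Fin n → α, ∑ a : α, F (Fin.snoc f a) := by
  rw [← (Fin.snocEquiv fun _ : Fin (n + 1) => α).sum_comp, Fintype.sum_prod_type_right]
  rfl

lemma filt_append_singleton [Fintype X] (s0 : X → ℝ) (p : X → U → X → Z → ℝ)
    (o : List (U × Z)) (u : U) (z : Z) (y : X) :
    filt s0 p (o ++ [(u, z)]) y = ∑ x, filt s0 p o x * p x u y z := by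
  simp [filt, filtAux]

variable [Fintype X] [Fintype U] [Fintype Z] [Nonempty X] [Nonempty Z]

lemma PrHS_zero (s0 : X → ℝ) (p : X → U → X → Z → ℝ) (π : List (U × Z) → U) (x : X) :
    PrHS s0 p π 0 [] x = s0 x := by
  rw [PrHS, sum_fin_snoc]
  simp [hist, extend_snoc_self]

/-- The joint law of history and state obeys the recursion of the unnormalized filter as long as
the last action is the one prescribed by the policy. -/
lemma PrHS_succ (s0 : X → ℝ) (p : X → U → X → Z → ℝ) (π : List (U × Z) → U) (t : ℕ)
    (o : List (U × Z)) (u : U) (z : Z) (y : X) :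
    PrHS s0 p π (t + 1) (o ++ [(u, z)]) y =
      if u = π o then ∑ x, PrHS s0 p π t o x * p x u y z else 0 := by
  have key : ∀ (f : Fin (t + 1) → X) (a : X) (g : Fin t → Z) (b : Z),
      (if hist π (extend (t + 1) (Fin.snoc g b : Fin (t + 1) → Z)) (t + 1) = o ++ [(u, z)] ∧
          extend (t + 1 + 1) (Fin.snoc f a : Fin (t + 1 + 1) → X) (t + 1) = y then
        s0 (extend (t + 1 + 1) (Fin.snoc f a : Fin (t + 1 + 1) → X) 0) *
          ∏ s ∈ Finset.range (t + 1),
            p (extend (t + 1 + 1) (Fin.snoc f a : Fin (t + 1 + 1) → X) s)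
              (π (hist π (extend (t + 1) (Fin.snoc g b : Fin (t + 1) → Z)) s))
              (extend (t + 1 + 1) (Fin.snoc f a : Fin (t + 1 + 1) → X) (s + 1))
              (extend (t + 1) (Fin.snoc g b : Fin (t + 1) → Z) s)
      else 0) =
      if a = y then if b = z then if u = π o then
        (if hist π (extend t g) t = o then
          (s0 (extend (t + 1) f 0) * ∏ s ∈ Finset.range t,
            p (extend (t + 1) f s) (π (hist π (extend t g) s))
              (extend (t + 1) f (s + 1)) (extend t g s)) * p (extend (t + 1) f t) u y z
        else 0) else 0 else 0 else 0 := by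
    intro f a g b
    have hprod : ∏ s ∈ Finset.range t,
            p (extend (t + 1 + 1) (Fin.snoc f a : Fin (t + 1 + 1) → X) s)
              (π (hist π (extend (t + 1) (Fin.snoc g b : Fin (t + 1) → Z)) s))
              (extend (t + 1 + 1) (Fin.snoc f a : Fin (t + 1 + 1) → X) (s + 1))
              (extend (t + 1) (Fin.snoc g b : Fin (t + 1) → Z) s) =
          ∏ s ∈ Finset.range t,
            p (extend (t + 1) f s) (π (hist π (extend t g) s))
              (extend (t + 1) f (s + 1)) (extend t g s) := by
      refine Finset.prod_congr rfl fun s hs => ?_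
      have hs : s < t := Finset.mem_range.mp hs
      rw [extend_snoc_of_lt f a (by omega), extend_snoc_of_lt f a (by omega),
        extend_snoc_of_lt g b hs, hist_extend_snoc π g b hs.le]
    rw [Finset.prod_range_succ, hprod, extend_snoc_self, extend_snoc_self,
      extend_snoc_of_lt f a (Nat.lt_succ_self t), extend_snoc_of_lt f a (Nat.succ_pos t), hist,
      hist_extend_snoc π g b le_rfl, extend_snoc_self]
    have hlast : hist π (extend t g) t ++ [(π (hist π (extend t g) t), b)] = o ++ [(u, z)] ↔
        hist π (extend t g) t = o ∧ u = π o ∧ b = z := by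
      rw [← List.concat_eq_append, ← List.concat_eq_append, List.concat_inj, Prod.mk.injEq]
      grind
    simp only [hlast]
    split_ifs <;> grind
  rw [PrHS, sum_fin_snoc]
  simp only [sum_fin_snoc (α := Z), key]
  split_ifs with hu
  · simp only [PrHS, Finset.sum_mul, ite_mul, zero_mul]
    conv_rhs => rw [Finset.sum_comm]
    refine Finset.sum_congr rfl fun f _ => ?_
    conv_rhs => rw [Finset.sum_comm]
    rw [Finset.sum_comm]
    refine Finset.sum_congr rfl fun g _ => ?_
    simp [ite_and]
  · simp

/-- A history either contradicts the policy, or its joint law with the state is the filter. -/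
lemma PrHS_eq_zero_or_eq_filt (s0 : X → ℝ) (p : X → U → X → Z → ℝ) (π : List (U × Z) → U)
    (o : List (U × Z)) :
    (∀ x, PrHS s0 p π o.length o x = 0) ∨ ∀ x, PrHS s0 p π o.length o x = filt s0 p o x := by
  induction o using List.reverseRecOn with
  | nil => exact Or.inr fun x => PrHS_zero s0 p π x
  | append_singleton o a ih =>
    obtain ⟨u, z⟩ := a
    simp only [List.length_append, List.length_singleton, PrHS_succ, filt_append_singleton]
    by_cases hu : u = π o
    · rcases ih with ih | ih
      · exact Or.inl fun y => by simp [ih]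
      · exact Or.inr fun y => by simp [hu, ih]
    · exact Or.inl fun y => by simp [hu]

end DecPOMDP

open DecPOMDP in
/-- Correctness and policy-independence of the Bayes filter: for every policy `π`,
every `t ≤ ℓ` and every history `o` of length `t` with `Pr_π(o_t = o) > 0`,
the history `o` is reachable and `Pr_π(x_t = x | o_t = o) = β(o)(x)` for every `x`;
the right-hand side does not depend on `π`. -/
theorem stmt13 (X U Z : Type) [Fintype X] [Nonempty X] [Fintype U] [Nonempty U]
    [Fintype Z] [Nonempty Z]
    (s0 : X → ℝ) (hs0 : ∀ x, 0 ≤ s0 x) (hs0sum : ∑ x, s0 x = 1)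
    (p : X → U → X → Z → ℝ) (hp : ∀ x u y z, 0 ≤ p x u y z)
    (hpsum : ∀ x u, ∑ y, ∑ z, p x u y z = 1)
    (r : X → U → ℝ) (γ : ℝ) (hγ0 : 0 ≤ γ) (hγ1 : γ ≤ 1) (ℓ : ℕ)
    (π : List (U × Z) → U) (t : ℕ) (ht : t ≤ ℓ)
    (o : List (U × Z)) (hlen : o.length = t)
    (hpos : 0 < PrH s0 p π t o) :
    reachable s0 p o ∧
      ∀ x, PrHS s0 p π t o x / PrH s0 p π t o = bel s0 p o x := by
  subst hlen
  rcases PrHS_eq_zero_or_eq_filt s0 p π o with h | h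
  · simp [PrH, h] at hpos
  · have hsum : PrH s0 p π o.length o = ∑ x, filt s0 p o x := by simp [PrH, h]
    exact ⟨hpos.trans_eq hsum, fun x => by rw [h, hsum, bel]⟩
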